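/- arXiv:1710.03176 — 4 statements merged into one kernel-verified Lean document; each statement's English description precedes it below -/
import Mathlib

section
/- Let A be an invertible real d×d matrix, Λ = Aℤ^d, and let Γ = {γ ∈ ℝ^d : ⟨λ, γ⟩ ∈ ℤ for all λ ∈ Λ} = (Aᵀ)⁻¹ℤ^d be the annihilator lattice of Λ. Let Ω ⊆ ℝ^d be a Lebesgue measurable set with 0 < |Ω| < ∞ and let ℓ be a positive integer. If there exist a₁, …, a_ℓ ∈ ℝ^d such that the family of exponentials {x ↦ e^{2πi⟨a_j+λ, x⟩} restricted to Ω : 1 ≤ j ≤ ℓ, λ ∈ Λ} is a frame of L²(Ω), then there exists an integer m with 1 ≤ m ≤ ℓ such that ∑_{γ∈Γ} 1_Ω(ω+γ) ≤ m for almost every ω ∈ ℝ^d and the set {ω ∈ ℝ^d : ∑_{γ∈Γ} 1_Ω(ω+γ) = m} has positive Lebesgue measure. -/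
open MeasureTheory ENNReal

/-- A family `φ i : α → ℂ` of functions is a frame for `L²(μ)` with frame bounds `A ≤ B`. -/
def IsFrameWith {α : Type*} [MeasurableSpace α] (μ : Measure α) {I : Type*}
    (φ : I → α → ℂ) (A B : ℝ) : Prop :=
  ∀ f : Lp ℂ 2 μ,
    A * ‖f‖ ^ 2 ≤ (∑' i : I, ‖∫ x, f x * (starRingEnd ℂ) (φ i x) ∂μ‖ ^ 2) ∧
    (∑' i : I, ‖∫ x, f x * (starRingEnd ℂ) (φ i x) ∂μ‖ ^ 2) ≤ B * ‖f‖ ^ 2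

/-- A family is a frame for `L²(μ)` if it has some frame bounds `0 < A ≤ B`. -/
def IsFrame {α : Type*} [MeasurableSpace α] (μ : Measure α) {I : Type*}
    (φ : I → α → ℂ) : Prop :=
  ∃ A B : ℝ, 0 < A ∧ A ≤ B ∧ IsFrameWith μ φ A B

/-- The lattice `A ℤ^d` in `ℝ^d`, for an invertible `d × d` real matrix `A`. -/
def latticeOf (d : ℕ) (A : Matrix (Fin d) (Fin d) ℝ) : Set (Fin d → ℝ) :=
  {v | ∃ k : Fin d → ℤ, v = A.mulVec fun i => (k i : ℝ)}

/-- The annihilator lattice `Γ = {γ : ⟨λ, γ⟩ ∈ ℤ for all λ ∈ A ℤ^d}` of the lattice `A ℤ^d`. -/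
def annihilatorOf (d : ℕ) (A : Matrix (Fin d) (Fin d) ℝ) : Set (Fin d → ℝ) :=
  {γ | ∀ v ∈ latticeOf d A, ∃ n : ℤ, (∑ i, v i * γ i) = (n : ℝ)}

/-- The exponential `x ↦ e^{2πi⟨b, x⟩}` on `ℝ^d`. -/
noncomputable def expChar {d : ℕ} (b : Fin d → ℝ) : (Fin d → ℝ) → ℂ :=
  fun x => Complex.exp (2 * Real.pi * Complex.I * (∑ i, b i * x i))

theorem expChar_add_right {d : ℕ} (b x y : Fin d → ℝ) :
    expChar b (x + y) = expChar b x * expChar b y := by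
  simp only [expChar, ← Complex.exp_add, Pi.add_apply]
  congr 1
  push_cast
  simp only [mul_add, Finset.sum_add_distrib]

theorem expChar_add_left {d : ℕ} (b c x : Fin d → ℝ) :
    expChar (b + c) x = expChar b x * expChar c x := by
  simp only [expChar, ← Complex.exp_add, Pi.add_apply]
  congr 1
  push_cast
  simp only [mul_add, add_mul, Finset.sum_add_distrib]

theorem expChar_eq_one_of_mem {d : ℕ} {A : Matrix (Fin d) (Fin d) ℝ} {v γ : Fin d → ℝ}
    (hv : v ∈ latticeOf d A) (hγ : γ ∈ annihilatorOf d A) : expChar v γ = 1 := by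
  obtain ⟨n, hn⟩ := hγ v hv
  rw [expChar, hn, mul_comm]
  exact Complex.exp_int_mul_two_pi_mul_I n

theorem norm_expChar {d : ℕ} (b x : Fin d → ℝ) : ‖expChar b x‖ = 1 := by
  have h : 2 * Real.pi * Complex.I * (∑ i, b i * x i : ℝ)
      = ((2 * Real.pi * ∑ i, b i * x i : ℝ) : ℂ) * Complex.I := by
    push_cast
    ring
  rw [expChar, h, Complex.norm_exp_ofReal_mul_I]

theorem continuous_expChar {d : ℕ} (b : Fin d → ℝ) : Continuous (expChar b) := by
  unfold expChar
  fun_prop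

theorem countable_annihilatorOf {d : ℕ} {A : Matrix (Fin d) (Fin d) ℝ} (hA : IsUnit A.det) :
    Countable (annihilatorOf d A) := by
  have hcol (j : Fin d) : A.col j ∈ latticeOf d A := by
    refine ⟨Pi.single j 1, ?_⟩
    have h : (fun i => ((Pi.single j 1 : Fin d → ℤ) i : ℝ)) = Pi.single j 1 := by
      ext i
      by_cases hij : i = j
      · subst hij
        simp
      · simp [hij]
    rw [h, Matrix.mulVec_single_one]
  choose n hn using fun (γ : annihilatorOf d A) (j : Fin d) => γ.2 _ (hcol j)
  refine Function.Injective.countable (f := n) fun γ δ h => Subtype.ext ?_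
  have hinj := Matrix.vecMul_injective_iff_isUnit.2 ((Matrix.isUnit_iff_isUnit_det A).2 hA)
  refine hinj (funext fun j => ?_)
  have h₁ := hn γ j
  have h₂ := hn δ j
  rw [h, ← h₂] at h₁
  simpa [Matrix.vecMul, dotProduct, Matrix.col_apply, mul_comm] using h₁

theorem zero_mem_annihilatorOf (d : ℕ) (A : Matrix (Fin d) (Fin d) ℝ) :
    (0 : Fin d → ℝ) ∈ annihilatorOf d A := fun _ _ => ⟨0, by simp⟩

/-- More unknowns than equations: a nontrivial relation between the values of the exponentials. -/
theorem exists_ne_zero_sum_mul_eq_zero {K : Type*} [Field K] {ℓ : ℕ}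
    (M : Fin ℓ → Fin (ℓ + 1) → K) :
    ∃ c : Fin (ℓ + 1) → K, c ≠ 0 ∧ ∀ j, ∑ k, c k * M j k = 0 := by
  have h := LinearMap.ker_ne_bot_of_finrank_lt (f := Matrix.mulVecLin (Matrix.of M)) (by simp)
  obtain ⟨c, hc, hc0⟩ := (Submodule.ne_bot_iff _).1 h
  refine ⟨c, hc0, fun j => ?_⟩
  have := congrFun (LinearMap.mem_ker.1 hc) j
  simpa [Matrix.mulVec, dotProduct, mul_comm] using this

/-- A set of positive measure contains a subset of positive measure whose translates by finitely
many given distinct vectors are disjoint. -/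
theorem exists_subset_pos_measure_disjoint_translates {d : ℕ} {ι : Type*} [Finite ι]
    {g : ι → Fin d → ℝ} (hg : Function.Injective g) {E : Set (Fin d → ℝ)}
    (hE : MeasurableSet E) (hpos : volume E ≠ 0) :
    ∃ E' ⊆ E, MeasurableSet E' ∧ volume E' ≠ 0 ∧
      ∀ x k l, x - g k ∈ E' → x - g l ∈ E' → k = l := by
  obtain ⟨x₀, -, hx₀⟩ := exists_mem_forall_mem_nhdsWithin_pos_measure hpos
  obtain ⟨r, hr, hsep⟩ : ∃ r > 0, ∀ k l, dist (g k) (g l) < r → k = l := by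
    have hev : ∀ᶠ r : ℝ in nhdsWithin 0 (Set.Ioi 0), ∀ k l, dist (g k) (g l) < r → k = l := by
      refine Filter.eventually_all.2 fun k => Filter.eventually_all.2 fun l => ?_
      by_cases hkl : k = l
      · simp [hkl]
      · have h : (0 : ℝ) < dist (g k) (g l) := dist_pos.2 (hg.ne hkl)
        filter_upwards [Ioo_mem_nhdsGT h] with r hr hlt
        exact absurd hlt hr.2.not_gt
    obtain ⟨r, h, hr⟩ := (hev.and self_mem_nhdsWithin).exists
    exact ⟨r, hr, h⟩
  refine ⟨E ∩ Metric.ball x₀ (r / 2), Set.inter_subset_left, hE.inter measurableSet_ball,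
    (hx₀ _ (inter_mem_nhdsWithin _ (Metric.ball_mem_nhds _ (half_pos hr)))).ne', ?_⟩
  rintro x k l ⟨-, hk⟩ ⟨-, hl⟩
  apply hsep
  have h := (dist_triangle_right (x - g k) (x - g l) x₀).trans_lt (add_lt_add hk hl)
  rwa [add_halves, dist_sub_left] at h

theorem integral_sum_translates_mul_expChar_eq_zero {d ℓ : ℕ} {A : Matrix (Fin d) (Fin d) ℝ}
    {g : Fin (ℓ + 1) → Fin d → ℝ} (hg : ∀ k, g k ∈ annihilatorOf d A) {E : Set (Fin d → ℝ)}
    (hE : MeasurableSet E) (hfin : volume E ≠ ∞) {c : Fin (ℓ + 1) → ℂ} {b v : Fin d → ℝ}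
    (hc : ∑ k, c k * (starRingEnd ℂ) (expChar b (g k)) = 0) (hv : v ∈ latticeOf d A) :
    ∫ x, (∑ k, E.indicator (fun _ => c k) (x - g k)) * (starRingEnd ℂ) (expChar (b + v) x) = 0 := by
  set e := fun x => (starRingEnd ℂ) (expChar (b + v) x) with he
  have hint (k : Fin (ℓ + 1)) : Integrable fun x => E.indicator (fun _ => c k) (x - g k) * e x := by
    refine Integrable.mul_bdd (c := 1) ?_ ?_ ?_
    · exact ((integrable_indicator_iff hE).2 (integrableOn_const hfin)).comp_sub_right (g k)
    · exact (Complex.continuous_conj.comp (continuous_expChar _)).aestronglyMeasurable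
    · exact Filter.Eventually.of_forall fun x => by simp [he, norm_expChar]
  have hterm (k : Fin (ℓ + 1)) : ∫ x, E.indicator (fun _ => c k) (x - g k) * e x
      = (c k * (starRingEnd ℂ) (expChar b (g k))) * ∫ x, E.indicator 1 x * e x := by
    rw [← integral_add_right_eq_self _ (g k), ← integral_const_mul]
    congr 1
    ext x
    have h : e (x + g k) = e x * (starRingEnd ℂ) (expChar b (g k)) := by
      simp only [he]
      rw [expChar_add_right, map_mul, expChar_add_left b v (g k), expChar_eq_one_of_mem hv (hg k),
        mul_one]
    rw [add_sub_cancel_right, h]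
    by_cases hx : x ∈ E
    · simp [hx]
      ring
    · simp [hx]
  simp_rw [Finset.sum_mul]
  rw [integral_finsetSum _ fun k _ => hint k]
  simp_rw [hterm]
  rw [← Finset.sum_mul, hc, zero_mul]

/-- A frame of exponentials with `ℓ` shifts forces any `ℓ + 1` translates of `Ω` along the
annihilator lattice to have a null intersection. -/
theorem measure_iInter_translates_eq_zero {d ℓ : ℕ} {A : Matrix (Fin d) (Fin d) ℝ}
    {Ω : Set (Fin d → ℝ)} (hΩ : MeasurableSet Ω) (hΩfin : volume Ω < ∞)
    {a : Fin ℓ → Fin d → ℝ}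
    (hframe : IsFrame (volume.restrict Ω)
      (fun p : Fin ℓ × latticeOf d A => expChar (a p.1 + (p.2 : Fin d → ℝ))))
    {g : Fin (ℓ + 1) → Fin d → ℝ} (hinj : Function.Injective g)
    (hg : ∀ k, g k ∈ annihilatorOf d A) :
    volume {ω | ∀ k, ω + g k ∈ Ω} = 0 := by
  by_contra hpos
  have hmeas : MeasurableSet {ω | ∀ k, ω + g k ∈ Ω} := by
    rw [Set.ofPred_forall]
    exact MeasurableSet.iInter fun k => measurable_add_const (g k) hΩ
  obtain ⟨E, hEsub, hE, hE0, hdisj⟩ :=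
    exists_subset_pos_measure_disjoint_translates hinj hmeas hpos
  have hEΩ (k : Fin (ℓ + 1)) : E ⊆ (fun x => x + g k) ⁻¹' Ω := fun x hx => hEsub hx k
  have hEfin : volume E ≠ ∞ := by
    refine ((measure_mono (hEΩ 0)).trans_lt ?_).ne
    rwa [measure_preimage_add_right]
  obtain ⟨c, hc0, hc⟩ := exists_ne_zero_sum_mul_eq_zero
    fun j k => (starRingEnd ℂ) (expChar (a j) (g k))
  set F : (Fin d → ℝ) → ℂ := fun x => ∑ k, E.indicator (fun _ => c k) (x - g k) with hF
  have hFmem : MemLp F 2 (volume.restrict Ω) := by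
    refine MemLp.restrict Ω (memLp_finsetSum _ fun k _ => ?_)
    exact (memLp_indicator_const 2 hE (c k) (Or.inr hEfin)).comp_measurePreserving
      (measurePreserving_sub_right volume (g k))
  have hFsupp (x : Fin d → ℝ) (hx : x ∉ Ω) : F x = 0 := by
    refine Finset.sum_eq_zero fun k _ => Set.indicator_of_notMem (fun h => hx ?_) _
    simpa using hEΩ k h
  obtain ⟨α, β, hα, -, hbound⟩ := hframe
  have hlow := (hbound (hFmem.toLp F)).1
  have hcoef (p : Fin ℓ × latticeOf d A) :
      ∫ x in Ω, hFmem.toLp F x * (starRingEnd ℂ) (expChar (a p.1 + (p.2 : Fin d → ℝ)) x) = 0 := by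
    refine Eq.trans ?_ ((setIntegral_eq_integral_of_forall_compl_eq_zero (s := Ω)
      fun x hx => mul_eq_zero_of_left (hFsupp x hx) _).trans
        (integral_sum_translates_mul_expChar_eq_zero hg hE hEfin (hc p.1) p.2.2))
    refine integral_congr_ae ?_
    filter_upwards [hFmem.coeFn_toLp] with x hx
    rw [hx]
  have hnorm : ‖hFmem.toLp F‖ = 0 := by
    simp only [hcoef, norm_zero, ne_eq, OfNat.ofNat_ne_zero, not_false_eq_true, zero_pow,
      tsum_zero] at hlow
    exact pow_eq_zero_iff two_ne_zero |>.1
      (le_antisymm (nonpos_of_mul_nonpos_right hlow hα) (sq_nonneg _))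
  have hzero : ∀ᵐ x, x ∈ Ω → F x = 0 := by
    rw [← ae_restrict_iff' hΩ]
    rw [norm_eq_zero] at hnorm
    filter_upwards [hFmem.coeFn_toLp, Lp.coeFn_zero ℂ 2 (volume.restrict Ω)] with x h₁ h₂
    rw [← h₁, hnorm, h₂, Pi.zero_apply]
  obtain ⟨k, hk⟩ := Function.ne_iff.1 hc0
  refine hE0 ?_
  rw [← measure_preimage_add_right volume (-g k) E]
  refine measure_mono_null (fun x hx => ?_) hzero
  have hx' : x - g k ∈ E := by simpa [sub_eq_add_neg] using hx
  have hxΩ : x ∈ Ω := by simpa using hEΩ k hx'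
  have hFx : F x = c k := by
    rw [hF]
    refine (Finset.sum_eq_single k (fun l _ hl => ?_) (by simp)).trans ?_
    · exact Set.indicator_of_notMem (fun h => hl (hdisj x l k h hx')) _
    · exact Set.indicator_of_mem hx' _
  exact fun h => hk (hFx.symm.trans (h hxΩ))

theorem exists_finset_of_lt_tsum_indicator {V ι : Type*} {Ω : Set V} {u : ι → V} {n : ℕ}
    (h : (n : ℝ≥0∞) < ∑' i, Ω.indicator (fun _ => (1 : ℝ≥0∞)) (u i)) :
    ∃ s : Finset ι, s.card = n + 1 ∧ ∀ i ∈ s, u i ∈ Ω := by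
  classical
  rw [ENNReal.tsum_eq_iSup_sum] at h
  obtain ⟨s, hs⟩ := lt_iSup_iff.1 h
  have hcard : n + 1 ≤ (s.filter fun i => u i ∈ Ω).card := by
    simp only [Set.indicator_apply, Finset.sum_boole] at hs
    exact_mod_cast hs
  obtain ⟨t, ht, htc⟩ := Finset.exists_subset_card_eq hcard
  exact ⟨t, htc, fun i hi => (Finset.mem_filter.1 (ht hi)).2⟩

theorem succ_le_tsum_indicator_of_lt {V ι : Type*} {Ω : Set V} {u : ι → V} {n : ℕ}
    (h : (n : ℝ≥0∞) < ∑' i, Ω.indicator (fun _ => (1 : ℝ≥0∞)) (u i)) :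
    ((n + 1 : ℕ) : ℝ≥0∞) ≤ ∑' i, Ω.indicator (fun _ => (1 : ℝ≥0∞)) (u i) := by
  obtain ⟨s, hs, hmem⟩ := exists_finset_of_lt_tsum_indicator h
  refine le_trans (le_of_eq ?_) (ENNReal.sum_le_tsum s)
  rw [Finset.sum_congr rfl fun i hi => Set.indicator_of_mem (hmem i hi) _]
  simp [hs]

/-- If for some `a₁, …, a_ℓ ∈ ℝ^d` the exponentials `e^{2πi⟨a_j + λ, ·⟩}`, `λ ∈ Λ = Aℤ^d`, form
a frame of `L²(Ω)`, then `(Ω, Γ)` is an `m`-subtiling pair of `ℝ^d` for some `1 ≤ m ≤ ℓ`, where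
`Γ` is the annihilator lattice of `Λ`. -/
theorem frame_of_exponentials_implies_subtiling_Rd
    (d : ℕ) (A : Matrix (Fin d) (Fin d) ℝ) (hA : IsUnit A.det)
    (Ω : Set (Fin d → ℝ)) (hΩmeas : MeasurableSet Ω)
    (hΩpos : 0 < volume Ω) (hΩfin : volume Ω < ∞)
    (ℓ : ℕ) (hℓ : 0 < ℓ) (a : Fin ℓ → (Fin d → ℝ))
    (hframe : IsFrame (volume.restrict Ω)
      (fun p : Fin ℓ × latticeOf d A => expChar (a p.1 + (p.2 : Fin d → ℝ)))) :
    ∃ m : ℕ, 1 ≤ m ∧ m ≤ ℓ ∧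
      (∀ᵐ ω : Fin d → ℝ, (∑' γ : annihilatorOf d A,
          Ω.indicator (fun _ => (1 : ℝ≥0∞)) (ω + (γ : Fin d → ℝ))) ≤ (m : ℝ≥0∞)) ∧
      0 < volume {ω : Fin d → ℝ | (∑' γ : annihilatorOf d A,
          Ω.indicator (fun _ => (1 : ℝ≥0∞)) (ω + (γ : Fin d → ℝ))) = (m : ℝ≥0∞)} := by
  classical
  have := countable_annihilatorOf hA
  have hle : ∀ᵐ ω : Fin d → ℝ, (∑' γ : annihilatorOf d A,
      Ω.indicator (fun _ => (1 : ℝ≥0∞)) (ω + (γ : Fin d → ℝ))) ≤ (ℓ : ℝ≥0∞) := by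
    have hnull : ∀ᵐ ω : Fin d → ℝ, ∀ g : Fin (ℓ + 1) → annihilatorOf d A,
        Function.Injective g → ¬ ∀ k, ω + (g k : Fin d → ℝ) ∈ Ω := by
      refine ae_all_iff.2 fun g => ?_
      by_cases hg : Function.Injective g
      · have h := measure_iInter_translates_eq_zero hΩmeas hΩfin hframe
          (Subtype.val_injective.comp hg) (fun k => (g k).2)
        filter_upwards [measure_eq_zero_iff_ae_notMem.1 h] with ω hω _ using hω
      · exact Filter.Eventually.of_forall fun ω h => absurd h hg
    filter_upwards [hnull] with ω hω
    by_contra! hlt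
    obtain ⟨s, hs, hmem⟩ := exists_finset_of_lt_tsum_indicator hlt
    let e := (s.equivFinOfCardEq hs).symm
    exact hω (fun k => (e k : annihilatorOf d A)) (Subtype.val_injective.comp e.injective)
      fun k => hmem _ (e k).2
  have hex : ∃ m : ℕ, ∀ᵐ ω : Fin d → ℝ, (∑' γ : annihilatorOf d A,
      Ω.indicator (fun _ => (1 : ℝ≥0∞)) (ω + (γ : Fin d → ℝ))) ≤ (m : ℝ≥0∞) := ⟨ℓ, hle⟩
  have hspec := Nat.find_spec hex
  have hone : 1 ≤ Nat.find hex := by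
    rw [Nat.one_le_iff_ne_zero]
    intro h0
    rw [h0] at hspec
    refine hΩpos.ne' (measure_eq_zero_iff_ae_notMem.2 ?_)
    filter_upwards [hspec] with ω hω hmem
    have h := (ENNReal.le_tsum (⟨0, zero_mem_annihilatorOf d A⟩ : annihilatorOf d A)).trans hω
    simp [hmem] at h
  refine ⟨Nat.find hex, hone, Nat.find_min' hex hle, hspec, pos_iff_ne_zero.2 fun hzero => ?_⟩
  refine Nat.find_min hex (Nat.sub_lt hone one_pos) ?_
  filter_upwards [hspec, measure_eq_zero_iff_ae_notMem.1 hzero] with ω hω hne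
  by_contra! hlt
  have h := succ_le_tsum_indicator_of_lt hlt
  rw [Nat.sub_add_cancel hone] at h
  exact hne (le_antisymm hω h)
end

section
/- Let Ω ⊆ ℝ^d be a bounded Lebesgue measurable set with |Ω| > 0 and let a₁, …, a_m ∈ ℝ^d. Then the following are equivalent: (i) the family of exponentials {x ↦ e^{2πi⟨a_j+λ, x⟩} restricted to Ω : 1 ≤ j ≤ m, λ ∈ ℤ^d} is a frame of L²(Ω); (ii) for almost every ω ∈ [0,1)^d, the finite family of vectors {(e^{2πi⟨a_1,k⟩}, e^{2πi⟨a_2,k⟩}, …, e^{2πi⟨a_m,k⟩}) ∈ ℂ^m : k ∈ ℤ^d with ω + k ∈ Ω} is linearly independent in ℂ^m. -/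
open MeasureTheory ENNReal

/-- The fundamental domain `[0,1)^d` of `ℤ^d` in `ℝ^d`. -/
def unitBox (d : ℕ) : Set (Fin d → ℝ) := Set.univ.pi fun _ => Set.Ico (0 : ℝ) 1

section Parseval

noncomputable local instance : MeasureSpace UnitAddCircle := ⟨AddCircle.haarAddCircle⟩

local instance : Measure.IsAddHaarMeasure (volume : Measure UnitAddCircle) :=
  inferInstanceAs (Measure.IsAddHaarMeasure AddCircle.haarAddCircle)

local instance : IsProbabilityMeasure (volume : Measure UnitAddCircle) :=
  inferInstanceAs (IsProbabilityMeasure AddCircle.haarAddCircle)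

open UnitAddTorus in
/-- **Parseval's identity** on the unit box. -/
theorem hasSum_sq_integral_unitBox {d : ℕ} {F : (Fin d → ℝ) → ℂ}
    (hF : MemLp F 2 (volume.restrict (unitBox d))) :
    HasSum (fun n : Fin d → ℤ =>
        ‖∫ x in unitBox d, F x * (starRingEnd ℂ) (expChar (fun i => (n i : ℝ)) x)‖ ^ 2)
      (∫ x in unitBox d, ‖F x‖ ^ 2) := by
  have hbox : volume.restrict (unitBox d) = volume.restrict
      {x : Fin d → ℝ | ∀ i, x i ∈ Set.Ioc ((0 : Fin d → ℝ) i) ((0 : Fin d → ℝ) i + 1)} := by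
    refine Measure.restrict_congr_set ?_
    have h1 := Measure.univ_pi_Ico_ae_eq_Icc (μ := fun _ : Fin d => (volume : Measure ℝ))
      (f := fun _ => 0) (g := fun _ => 1)
    have h2 := Measure.univ_pi_Ioc_ae_eq_Icc (μ := fun _ : Fin d => (volume : Measure ℝ))
      (f := fun _ => 0) (g := fun _ => 1)
    have h3 : {x : Fin d → ℝ | ∀ i, x i ∈ Set.Ioc ((0 : Fin d → ℝ) i) ((0 : Fin d → ℝ) i + 1)} =
        Set.univ.pi fun _ => Set.Ioc (0 : ℝ) 1 := by
      ext x; simp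
    rw [h3]
    exact h1.trans h2.symm
  have hmeas : MeasurableSet
      {x : Fin d → ℝ | ∀ i, x i ∈ Set.Ioc ((0 : Fin d → ℝ) i) ((0 : Fin d → ℝ) i + 1)} :=
    MeasurableSet.univ_pi' (fun i => measurableSet_Ioc)
  let s : UnitAddTorus (Fin d) → (Fin d → ℝ) := fun t => (measurableEquivPiIoc 0 t).1
  have hs : MeasurePreserving s volume (volume.restrict (unitBox d)) := by
    rw [hbox]
    exact (measurePreserving_subtype_coe hmeas).comp (measurePreserving_equivPiIoc 0)
  have hse : MeasurableEmbedding s :=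
    (MeasurableEmbedding.subtype_coe hmeas).comp (measurableEquivPiIoc 0).measurableEmbedding
  have hchar : ∀ (n : Fin d → ℤ) (t : UnitAddTorus (Fin d)),
      mFourier n t = expChar (fun i => (n i : ℝ)) (s t) := by
    intro n t
    have ht : t = fun i => ((s t i : ℝ) : UnitAddCircle) := by
      have := (measurableEquivPiIoc (0 : Fin d → ℝ)).symm_apply_apply t
      exact this.symm
    conv_lhs => rw [ht]
    simp only [mFourier, ContinuousMap.coe_mk, fourier_coe_apply, expChar]
    rw [← Complex.exp_sum, Complex.ofReal_sum, Finset.mul_sum]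
    congr 1
    refine Finset.sum_congr rfl fun i _ => ?_
    push_cast
    ring
  have hG : MemLp (F ∘ s) 2 (volume : Measure (UnitAddTorus (Fin d))) :=
    hF.comp_measurePreserving hs
  have key := hasSum_sq_mFourierCoeff (hG.toLp _)
  have e1 : ∫ t, ‖hG.toLp _ t‖ ^ 2 = ∫ x in unitBox d, ‖F x‖ ^ 2 := by
    rw [← hs.integral_comp hse]
    refine integral_congr_ae ?_
    filter_upwards [hG.coeFn_toLp] with t ht
    rw [ht]; rfl
  rw [e1] at key
  convert key using 3 with n
  rw [← hs.integral_comp hse, mFourierCoeff]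
  congr 1
  refine integral_congr_ae ?_
  filter_upwards [hG.coeFn_toLp] with t ht
  rw [ht, mFourier_neg, hchar, smul_eq_mul, mul_comm]
  rfl

end Parseval

/-- The coordinatewise floor of a vector in `ℝ^d`. -/
noncomputable def floorVec {d : ℕ} (x : Fin d → ℝ) : Fin d → ℤ := fun i => ⌊x i⌋

/-- An integer vector, viewed in `ℝ^d`. -/
def intVec {d : ℕ} (k : Fin d → ℤ) : Fin d → ℝ := fun i => (k i : ℝ)

theorem floorVec_add_intVec {d : ℕ} {ω : Fin d → ℝ} (hω : ω ∈ unitBox d) (k : Fin d → ℤ) :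
    floorVec (ω + intVec k) = k := by
  ext i
  have := hω i trivial
  simp only [floorVec, intVec, Pi.add_apply, Int.floor_add_intCast]
  rw [Int.floor_eq_zero_iff.2 this, zero_add]

theorem sub_floorVec_mem {d : ℕ} (x : Fin d → ℝ) : x - intVec (floorVec x) ∈ unitBox d := by
  intro i _
  simp only [floorVec, intVec, Pi.sub_apply]
  exact ⟨Int.fract_nonneg _, Int.fract_lt_one _⟩

theorem measurableSet_unitBox (d : ℕ) : MeasurableSet (unitBox d) :=
  MeasurableSet.univ_pi fun _ => measurableSet_Ico

theorem measurable_floorVec {d : ℕ} : Measurable (floorVec (d := d)) :=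
  measurable_pi_lambda _ fun i => Int.measurable_floor.comp (measurable_pi_apply i)

/-- The integral over `ℝ^d` of a function supported in finitely many integer translates of the
unit box is the integral of its periodization. -/
theorem integral_eq_integral_unitBox_sum {d : ℕ} {E : Type*} [NormedAddCommGroup E]
    [NormedSpace ℝ E] {g : (Fin d → ℝ) → E} (hg : Integrable g) (K : Finset (Fin d → ℤ))
    (hK : ∀ x, floorVec x ∉ K → g x = 0) :
    ∫ x, g x = ∫ ω in unitBox d, ∑ k ∈ K, g (ω + intVec k) := by
  have hmeas : ∀ k : Fin d → ℤ, MeasurableSet (floorVec ⁻¹' {k} : Set (Fin d → ℝ)) := fun k =>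
    measurable_floorVec (measurableSet_singleton k)
  have hsupp : ∫ x, g x = ∫ x in ⋃ k ∈ K, floorVec ⁻¹' {k}, g x := by
    refine (setIntegral_eq_integral_of_forall_compl_eq_zero fun x hx => hK x ?_).symm
    simpa using hx
  rw [hsupp, integral_biUnion_finset K (fun k _ => hmeas k) _ (fun k _ => hg.integrableOn),
    integral_finsetSum]
  · refine Finset.sum_congr rfl fun k _ => ?_
    have hpre : (fun x => x + intVec k) ⁻¹' (floorVec ⁻¹' {k}) = unitBox d := by
      ext ω
      refine ⟨fun h => ?_, fun h => floorVec_add_intVec h k⟩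
      have h1 := sub_floorVec_mem (ω + intVec k)
      rw [show floorVec (ω + intVec k) = k from h] at h1
      simpa using h1
    rw [← (measurePreserving_add_right volume (intVec k)).setIntegral_preimage_emb
      (measurableEmbedding_addRight _), hpre]
  · exact fun k _ => (hg.comp_add_right (intVec k)).integrableOn
  · intro k _ l _ hkl
    exact Disjoint.preimage _ (by simpa using hkl)

theorem expChar_intVec_intVec {d : ℕ} (n k : Fin d → ℤ) : expChar (intVec n) (intVec k) = 1 := by
  rw [expChar, Complex.exp_eq_one_iff]
  refine ⟨∑ i, n i * k i, ?_⟩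
  simp only [intVec]
  push_cast
  ring

theorem exists_finset_floorVec_mem {d : ℕ} {Ω : Set (Fin d → ℝ)} (hΩ : Bornology.IsBounded Ω) :
    ∃ K : Finset (Fin d → ℤ), ∀ x ∈ Ω, floorVec x ∈ K := by
  obtain ⟨r, hr⟩ := hΩ.subset_closedBall 0
  refine ⟨Finset.Icc (fun _ => ⌊-r⌋) (fun _ => ⌊r⌋), fun x hx => ?_⟩
  have hx' : ∀ i, |x i| ≤ r := fun i => by
    have h1 := norm_le_pi_norm x i
    have h2 := hr hx
    rw [mem_closedBall_zero_iff] at h2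
    exact h1.trans h2
  exact Finset.mem_Icc.2 ⟨fun i => Int.floor_mono (abs_le.1 (hx' i)).1,
    fun i => Int.floor_mono (abs_le.1 (hx' i)).2⟩

section Periodization

variable {d : ℕ} {Ω : Set (Fin d → ℝ)} {f : (Fin d → ℝ) → ℂ} {K : Finset (Fin d → ℤ)}

theorem integral_sq_norm_eq (hΩ : MeasurableSet Ω) (hf : MemLp f 2 (volume.restrict Ω))
    (hK : ∀ x ∈ Ω, floorVec x ∈ K) :
    ∫ x in Ω, ‖f x‖ ^ 2 =
      ∫ ω in unitBox d, ∑ k ∈ K, ‖Ω.indicator f (ω + intVec k)‖ ^ 2 := by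
  have hf' : MemLp (Ω.indicator f) 2 := (memLp_indicator_iff_restrict hΩ).2 hf
  rw [← integral_indicator hΩ, ← integral_eq_integral_unitBox_sum
    (g := fun x => ‖Ω.indicator f x‖ ^ 2) hf'.norm.integrable_sq K]
  · congr 1
    ext x
    by_cases hx : x ∈ Ω <;> simp [hx]
  · intro x hx
    rw [Set.indicator_of_notMem (fun h => hx (hK x h))]
    simp

theorem hasSum_sq_norm_coeff (hΩ : MeasurableSet Ω) (hΩb : Bornology.IsBounded Ω)
    (hf : MemLp f 2 (volume.restrict Ω)) (hK : ∀ x ∈ Ω, floorVec x ∈ K) (b : Fin d → ℝ) :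
    HasSum (fun n : Fin d → ℤ =>
        ‖∫ x in Ω, f x * (starRingEnd ℂ) (expChar (b + fun i => (n i : ℝ)) x)‖ ^ 2)
      (∫ ω in unitBox d, ‖∑ k ∈ K, Ω.indicator f (ω + intVec k) *
        (starRingEnd ℂ) (expChar b (intVec k))‖ ^ 2) := by
  have : IsFiniteMeasure (volume.restrict Ω) := ⟨by simpa using hΩb.measure_lt_top⟩
  set h : (Fin d → ℝ) → ℂ := fun x => Ω.indicator f x * (starRingEnd ℂ) (expChar b x) with h_def
  have hf' : MemLp (Ω.indicator f) 2 := (memLp_indicator_iff_restrict hΩ).2 hf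
  have hconj : ∀ c : Fin d → ℝ, Continuous fun x => (starRingEnd ℂ) (expChar c x) := fun c =>
    Complex.continuous_conj.comp (continuous_expChar c)
  have hh : MemLp h 2 := hf'.congr_norm
    (hf'.aestronglyMeasurable.mul (hconj b).aestronglyMeasurable)
    (Filter.Eventually.of_forall fun x => by simp [h_def, norm_expChar])
  have hfi : Integrable (Ω.indicator f) :=
    (integrable_indicator_iff hΩ).2 (hf.integrable (by norm_num))
  have hF : MemLp (fun ω => ∑ k ∈ K, h (ω + intVec k)) 2 (volume.restrict (unitBox d)) :=
    memLp_finsetSum K fun k _ =>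
      (hh.comp_measurePreserving (measurePreserving_add_right volume (intVec k))).restrict _
  convert hasSum_sq_integral_unitBox hF using 1
  · ext n
    congr 2
    have hi : Integrable
        (fun x => Ω.indicator f x * (starRingEnd ℂ) (expChar (b + intVec n) x)) :=
      hfi.congr' (hfi.aestronglyMeasurable.mul (hconj _).aestronglyMeasurable)
        (Filter.Eventually.of_forall fun x => by simp [norm_expChar])
    have h1 : ∫ x in Ω, f x * (starRingEnd ℂ) (expChar (b + fun i => (n i : ℝ)) x) =
        ∫ x, Ω.indicator f x * (starRingEnd ℂ) (expChar (b + intVec n) x) := by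
      rw [← integral_indicator hΩ]
      congr 1
      ext x
      by_cases hx : x ∈ Ω
      · simp only [Set.indicator_of_mem hx]
        rfl
      · simp [hx]
    rw [h1, integral_eq_integral_unitBox_sum hi K]
    · congr 1
      ext ω
      rw [Finset.sum_mul]
      refine Finset.sum_congr rfl fun k _ => ?_
      rw [expChar_add_left, expChar_add_right (intVec n), expChar_intVec_intVec, h_def]
      simp only [map_mul, mul_one]
      exact (mul_assoc _ _ _).symm
    · intro x hx
      rw [Set.indicator_of_notMem (fun h => hx (hK x h)), zero_mul]
  · congr 1
    ext ω
    have : ∑ k ∈ K, h (ω + intVec k) = (starRingEnd ℂ) (expChar b ω) *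
        ∑ k ∈ K, Ω.indicator f (ω + intVec k) * (starRingEnd ℂ) (expChar b (intVec k)) := by
      rw [Finset.mul_sum]
      refine Finset.sum_congr rfl fun k _ => ?_
      simp only [h_def, expChar_add_right, map_mul]
      ring
    rw [this, norm_mul, RCLike.norm_conj, norm_expChar, one_mul]

theorem integrable_sq_norm_sum (hΩ : MeasurableSet Ω)
    (hf : MemLp f 2 (volume.restrict Ω)) (c : (Fin d → ℤ) → ℂ) :
    IntegrableOn (fun ω => ‖∑ k ∈ K, Ω.indicator f (ω + intVec k) * c k‖ ^ 2) (unitBox d) := by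
  have hf' : MemLp (Ω.indicator f) 2 := (memLp_indicator_iff_restrict hΩ).2 hf
  have hF : MemLp (fun ω => ∑ k ∈ K, Ω.indicator f (ω + intVec k) * c k) 2
      (volume.restrict (unitBox d)) :=
    memLp_finsetSum K fun k _ =>
      ((hf'.comp_measurePreserving (measurePreserving_add_right volume (intVec k))).restrict
        _).mul_const (c k)
  exact hF.norm.integrable_sq

theorem tsum_sq_norm_coeff {m : ℕ} (hΩ : MeasurableSet Ω) (hΩb : Bornology.IsBounded Ω)
    (hf : MemLp f 2 (volume.restrict Ω)) (hK : ∀ x ∈ Ω, floorVec x ∈ K)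
    (a : Fin m → Fin d → ℝ) :
    ∑' p : Fin m × (Fin d → ℤ),
        ‖∫ x in Ω, f x * (starRingEnd ℂ) (expChar (a p.1 + fun i => (p.2 i : ℝ)) x)‖ ^ 2 =
      ∫ ω in unitBox d, ∑ j, ‖∑ k ∈ K, Ω.indicator f (ω + intVec k) *
        (starRingEnd ℂ) (expChar (a j) (intVec k))‖ ^ 2 := by
  have hs := fun j => hasSum_sq_norm_coeff hΩ hΩb hf hK (a j)
  rw [Summable.tsum_prod, tsum_fintype, integral_finsetSum]
  · exact Finset.sum_congr rfl fun j _ => (hs j).tsum_eq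
  · exact fun j _ => integrable_sq_norm_sum hΩ hf _
  · exact (summable_prod_of_nonneg fun p => by positivity).2
      ⟨fun j => (hs j).summable, Summable.of_finite⟩

end Periodization

theorem LinearIndependent.exists_pos_mul_sum_sq_le {ι κ : Type*} [Fintype ι] [Fintype κ]
    {v : ι → κ → ℂ} (hv : LinearIndependent ℂ v) :
    ∃ A : ℝ, 0 < A ∧ ∀ c : ι → ℂ, A * ∑ i, ‖c i‖ ^ 2 ≤ ∑ j, ‖∑ i, c i * v i j‖ ^ 2 := by
  let T : EuclideanSpace ℂ ι →ₗ[ℂ] EuclideanSpace ℂ κ :=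
    (WithLp.linearEquiv 2 ℂ (κ → ℂ)).symm.toLinearMap ∘ₗ Fintype.linearCombination ℂ v ∘ₗ
      (WithLp.linearEquiv 2 ℂ (ι → ℂ)).toLinearMap
  have hT : LinearMap.ker T = ⊥ := by
    rw [LinearMap.ker_eq_bot]
    exact (WithLp.linearEquiv 2 ℂ (κ → ℂ)).symm.injective.comp
      (hv.fintypeLinearCombination_injective.comp (WithLp.linearEquiv 2 ℂ (ι → ℂ)).injective)
  obtain ⟨C, hC, hTC⟩ := T.exists_antilipschitzWith hT
  have hC' : (0 : ℝ) < C := hC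
  refine ⟨((C : ℝ) ^ 2)⁻¹, by positivity, fun c => ?_⟩
  have h1 := hTC.le_mul_norm (map_zero T) (WithLp.toLp 2 c)
  have h2 : ‖WithLp.toLp 2 c‖ ^ 2 ≤ (C * ‖T (WithLp.toLp 2 c)‖) ^ 2 := by gcongr
  rw [mul_pow, EuclideanSpace.norm_sq_eq, EuclideanSpace.norm_sq_eq] at h2
  rw [inv_mul_le_iff₀ (by positivity)]
  simpa [T, Fintype.linearCombination_apply, Finset.sum_apply] using h2

theorem exists_pos_mul_sum_sq_le_of_linearIndepOn {ι κ : Type*} [Fintype κ] (K : Finset ι)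
    (v : ι → κ → ℂ) :
    ∃ A : ℝ, 0 < A ∧ ∀ (s : Set ι) (c : ι → ℂ), LinearIndepOn ℂ v s →
      (∀ k ∈ K, c k ≠ 0 → k ∈ s) →
      A * ∑ k ∈ K, ‖c k‖ ^ 2 ≤ ∑ j, ‖∑ k ∈ K, c k * v k j‖ ^ 2 := by
  classical
  have hθ : ∀ θ : Finset ι, ∃ A : ℝ, 0 < A ∧ (LinearIndepOn ℂ v (θ : Set ι) →
      ∀ c : ι → ℂ, A * ∑ k ∈ θ, ‖c k‖ ^ 2 ≤ ∑ j, ‖∑ k ∈ θ, c k * v k j‖ ^ 2) := by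
    intro θ
    by_cases h : LinearIndepOn ℂ v (θ : Set ι)
    · obtain ⟨A, hA, hAc⟩ := LinearIndependent.exists_pos_mul_sum_sq_le (ι := θ) h
      refine ⟨A, hA, fun _ c => ?_⟩
      have := hAc fun k => c k
      rw [Finset.sum_coe_sort θ fun k => ‖c k‖ ^ 2] at this
      refine this.trans_eq (Finset.sum_congr rfl fun j _ => ?_)
      rw [← Finset.sum_coe_sort θ fun k => c k * v k j]
    · exact ⟨1, one_pos, fun h' => absurd h' h⟩
  choose A hA hAc using hθ
  obtain ⟨θ₀, -, hmin⟩ := Finset.exists_min_image K.powerset A ⟨∅, by simp⟩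
  refine ⟨A θ₀, hA θ₀, fun s c hs hc => ?_⟩
  have h1 : ∑ k ∈ K, ‖c k‖ ^ 2 = ∑ k ∈ K with c k ≠ 0, ‖c k‖ ^ 2 :=
    (Finset.sum_filter_of_ne (p := fun k => c k ≠ 0) fun k _ hk h0 => hk (by simp [h0])).symm
  have h2 : ∀ j, ∑ k ∈ K, c k * v k j = ∑ k ∈ K with c k ≠ 0, c k * v k j := fun j =>
    (Finset.sum_filter_of_ne (p := fun k => c k ≠ 0) fun k _ hk h0 => hk (by simp [h0])).symm
  simp_rw [h1, h2]
  refine le_trans ?_ (hAc {k ∈ K | c k ≠ 0} (hs.mono fun k hk => ?_) c)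
  · gcongr
    exact hmin _ (by simp)
  · obtain ⟨hkK, hk⟩ := Finset.mem_filter.1 (Finset.mem_coe.1 hk)
    exact hc k hkK hk

theorem sum_sq_norm_sum_le {ι κ : Type*} [Fintype κ] (K : Finset ι) {v : ι → κ → ℂ}
    (hv : ∀ k j, ‖v k j‖ = 1) (c : ι → ℂ) :
    ∑ j, ‖∑ k ∈ K, c k * v k j‖ ^ 2 ≤ Fintype.card κ * K.card * ∑ k ∈ K, ‖c k‖ ^ 2 := by
  have h : ∀ j, ‖∑ k ∈ K, c k * v k j‖ ^ 2 ≤ K.card * ∑ k ∈ K, ‖c k‖ ^ 2 := fun j => by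
    have h1 : ‖∑ k ∈ K, c k * v k j‖ ≤ ∑ k ∈ K, ‖c k‖ := by
      simpa [hv] using norm_sum_le K fun k => c k * v k j
    calc _ ≤ (∑ k ∈ K, ‖c k‖) ^ 2 := by gcongr
      _ ≤ _ := sq_sum_le_card_mul_sum_sq
  calc _ ≤ ∑ _j : κ, (K.card : ℝ) * ∑ k ∈ K, ‖c k‖ ^ 2 := Finset.sum_le_sum fun j _ => h j
    _ = _ := by simp [mul_assoc]

theorem sq_norm_eq_integral {α : Type*} [MeasurableSpace α] {μ : Measure α} (f : Lp ℂ 2 μ) :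
    ‖f‖ ^ 2 = ∫ x, ‖f x‖ ^ 2 ∂μ := by
  rw [← inner_self_eq_norm_sq (𝕜 := ℂ), L2.inner_def, ← integral_re (L2.integrable_inner f f)]
  simp only [inner_self_eq_norm_sq]

section Frame

variable {d m : ℕ} {Ω : Set (Fin d → ℝ)} {K : Finset (Fin d → ℤ)} {a : Fin m → Fin d → ℝ}

theorem isFrame_of_ae_linearIndepOn (hΩ : MeasurableSet Ω) (hΩb : Bornology.IsBounded Ω)
    (hK : ∀ x ∈ Ω, floorVec x ∈ K)
    (h : ∀ᵐ ω ∂(volume.restrict (unitBox d)),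
      LinearIndepOn ℂ (fun k j => expChar (a j) (intVec k)) {k | ω + intVec k ∈ Ω}) :
    IsFrame (volume.restrict Ω)
      (fun p : Fin m × (Fin d → ℤ) => expChar (a p.1 + fun i => (p.2 i : ℝ))) := by
  obtain ⟨A, hA, hAc⟩ := exists_pos_mul_sum_sq_le_of_linearIndepOn K
    fun (k : Fin d → ℤ) (j : Fin m) => expChar (a j) (intVec k)
  refine ⟨A, max A (m * K.card), hA, le_max_left _ _, fun f => ?_⟩
  have hf := Lp.memLp f
  have hf' : MemLp (Ω.indicator f) 2 := (memLp_indicator_iff_restrict hΩ).2 hf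
  have hsq : IntegrableOn (fun ω => ∑ k ∈ K, ‖Ω.indicator f (ω + intVec k)‖ ^ 2) (unitBox d) :=
    integrable_finsetSum K fun k _ => ((hf'.comp_measurePreserving
      (measurePreserving_add_right volume (intVec k))).restrict _).norm.integrable_sq
  have hsum : IntegrableOn (fun ω => ∑ j, ‖∑ k ∈ K, Ω.indicator f (ω + intVec k) *
      (starRingEnd ℂ) (expChar (a j) (intVec k))‖ ^ 2) (unitBox d) :=
    integrable_finsetSum _ fun j _ => integrable_sq_norm_sum hΩ hf _
  rw [tsum_sq_norm_coeff hΩ hΩb hf hK, sq_norm_eq_integral, integral_sq_norm_eq hΩ hf hK,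
    ← integral_const_mul, ← integral_const_mul]
  constructor
  · refine integral_mono_ae (hsq.const_mul _) hsum ?_
    filter_upwards [h] with ω hω
    have := hAc _ (fun k => (starRingEnd ℂ) (Ω.indicator f (ω + intVec k))) hω
      (fun k _ hk => by
        by_contra hn
        have hn' : ω + intVec k ∉ Ω := hn
        exact hk (by rw [Set.indicator_of_notMem hn', map_zero]))
    simp only [RCLike.norm_conj] at this
    refine this.trans_eq (Finset.sum_congr rfl fun j _ => ?_)
    rw [← RCLike.norm_conj, map_sum]
    simp
  · refine integral_mono_ae hsum (hsq.const_mul _) (Filter.Eventually.of_forall fun ω => ?_)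
    refine (sum_sq_norm_sum_le K (v := fun k j => (starRingEnd ℂ) (expChar (a j) (intVec k)))
      (fun k j => by simp [norm_expChar]) fun k => Ω.indicator f (ω + intVec k)).trans ?_
    dsimp only
    gcongr
    simp

theorem IsFrame.volume_eq_zero (hΩ : MeasurableSet Ω) (hΩb : Bornology.IsBounded Ω)
    (hK : ∀ x ∈ Ω, floorVec x ∈ K)
    (h : IsFrame (volume.restrict Ω)
      (fun p : Fin m × (Fin d → ℤ) => expChar (a p.1 + fun i => (p.2 i : ℝ))))
    {θ : Finset (Fin d → ℤ)}
    (hθ : ¬ LinearIndepOn ℂ (fun k j => expChar (a j) (intVec k)) (θ : Set (Fin d → ℤ))) :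
    volume {ω ∈ unitBox d | {k | ω + intVec k ∈ Ω} = (θ : Set (Fin d → ℤ))} = 0 := by
  classical
  obtain ⟨A, B, hA, -, hAB⟩ := h
  have : IsFiniteMeasure (volume.restrict Ω) := ⟨by simpa using hΩb.measure_lt_top⟩
  rw [linearIndepOn_finset_iff] at hθ
  push Not at hθ
  obtain ⟨g, hg, k₀, hk₀, hgk₀⟩ := hθ
  set W := {ω ∈ unitBox d | {k | ω + intVec k ∈ Ω} = (θ : Set (Fin d → ℤ))} with hW_def
  have hW : MeasurableSet W := by
    have : W = unitBox d ∩ ⋂ k : Fin d → ℤ, {ω | ω + intVec k ∈ Ω ↔ k ∈ θ} := by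
      ext ω
      simp [hW_def, Set.ext_iff]
    rw [this]
    refine (measurableSet_unitBox d).inter (MeasurableSet.iInter fun k => ?_)
    exact (hΩ.preimage (measurable_add_const (intVec k))).iff (MeasurableSet.const _)
  set c : (Fin d → ℤ) → ℂ := fun k => if k ∈ θ then (starRingEnd ℂ) (g k) else 0 with hc
  have hc_bdd : ∀ k, ‖c k‖ ≤ ∑ k ∈ θ, ‖g k‖ := by
    intro k
    by_cases hk : k ∈ θ
    · simpa [hc, hk] using
        Finset.single_le_sum (f := fun k => ‖g k‖) (fun _ _ => norm_nonneg _) hk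
    · simpa [hc, hk] using Finset.sum_nonneg fun k _ => norm_nonneg (g k)
  set f : (Fin d → ℝ) → ℂ := fun x =>
    W.indicator (fun _ => c (floorVec x)) (x - intVec (floorVec x)) with hf_def
  have hf_add : ∀ ω ∈ unitBox d, ∀ k, f (ω + intVec k) = if ω ∈ W then c k else 0 := by
    intro ω hω k
    simp only [hf_def, floorVec_add_intVec hω, add_sub_cancel_right, Set.indicator_apply]
  have hf_ind : ∀ ω ∈ unitBox d, ∀ k,
      Ω.indicator f (ω + intVec k) = if ω ∈ W then c k else 0 := by
    intro ω hω k
    by_cases hx : ω + intVec k ∈ Ω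
    · rw [Set.indicator_of_mem hx, hf_add ω hω]
    · rw [Set.indicator_of_notMem hx]
      split_ifs with hωW
      · have hkθ : k ∉ θ := fun hk => hx <| by
          have : k ∈ (θ : Set (Fin d → ℤ)) := hk
          rwa [← hωW.2] at this
        simp [hc, hkθ]
      · rfl
  have hf_meas : Measurable f := by
    have hfl : Measurable fun x : Fin d → ℝ => x - intVec (floorVec x) :=
      measurable_id.sub ((Measurable.of_discrete (f := intVec)).comp measurable_floorVec)
    have : f = (((fun x => x - intVec (floorVec x)) ⁻¹' W)).indicator
        fun x => c (floorVec x) := by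
      ext x
      simp [hf_def, Set.indicator_apply]
    rw [this]
    exact ((Measurable.of_discrete (f := c)).comp measurable_floorVec).indicator (hfl hW)
  have hf : MemLp f 2 (volume.restrict Ω) := by
    refine MemLp.of_bound hf_meas.aestronglyMeasurable (∑ k ∈ θ, ‖g k‖)
      (Filter.Eventually.of_forall fun x => ?_)
    refine (norm_indicator_le_norm_self _ _).trans (hc_bdd _)
  have hbound := (hAB (hf.toLp f)).1
  have e1 : ‖hf.toLp f‖ ^ 2 = ∫ ω in unitBox d, ∑ k ∈ K, ‖Ω.indicator f (ω + intVec k)‖ ^ 2 := by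
    rw [sq_norm_eq_integral, ← integral_sq_norm_eq hΩ hf hK]
    refine integral_congr_ae ?_
    filter_upwards [hf.coeFn_toLp] with x hx
    rw [hx]
  by_contra hWpos
  obtain ⟨ω₀, hω₀⟩ := nonempty_of_measure_ne_zero hWpos
  have hθK : θ ⊆ K := by
    intro k hk
    have h1 : k ∈ (θ : Set (Fin d → ℤ)) := hk
    rw [← hω₀.2] at h1
    simpa [floorVec_add_intVec hω₀.1] using hK _ h1
  have hsum0 : ∀ j, ∑ k ∈ K, c k * (starRingEnd ℂ) (expChar (a j) (intVec k)) = 0 := by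
    intro j
    rw [← Finset.sum_subset hθK fun k _ hk => by simp [hc, hk]]
    have := congrArg (starRingEnd ℂ) (congrFun hg j)
    simp only [Finset.sum_apply, Pi.smul_apply, smul_eq_mul, map_sum, map_mul, Pi.zero_apply,
      map_zero] at this
    rw [← this]
    exact Finset.sum_congr rfl fun k hk => by simp [hc, hk]
  have e2 : ∫ ω in unitBox d, ∑ k ∈ K, ‖Ω.indicator f (ω + intVec k)‖ ^ 2 =
      volume.real W * ∑ k ∈ K, ‖c k‖ ^ 2 := by
    have : ∀ ω ∈ unitBox d, ∑ k ∈ K, ‖Ω.indicator f (ω + intVec k)‖ ^ 2 =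
        W.indicator (fun _ => ∑ k ∈ K, ‖c k‖ ^ 2) ω := by
      intro ω hω
      simp only [hf_ind ω hω, Set.indicator_apply]
      split_ifs <;> simp
    rw [setIntegral_congr_fun (measurableSet_unitBox d) this, setIntegral_indicator hW,
      Set.inter_eq_right.2 fun ω hω => hω.1, setIntegral_const, smul_eq_mul]
  have e3 : ∑' p : Fin m × (Fin d → ℤ), ‖∫ x in Ω, hf.toLp f x *
      (starRingEnd ℂ) (expChar (a p.1 + fun i => (p.2 i : ℝ)) x)‖ ^ 2 = 0 := by
    have hcongr : ∀ b : Fin d → ℝ, ∫ x in Ω, hf.toLp f x * (starRingEnd ℂ) (expChar b x) =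
        ∫ x in Ω, f x * (starRingEnd ℂ) (expChar b x) := fun b => by
      refine integral_congr_ae ?_
      filter_upwards [hf.coeFn_toLp] with x hx
      rw [hx]
    simp_rw [hcongr]
    rw [tsum_sq_norm_coeff hΩ hΩb hf hK]
    refine setIntegral_eq_zero_of_forall_eq_zero fun ω hω => Finset.sum_eq_zero fun j _ => ?_
    simp only [hf_ind ω hω]
    split_ifs
    · simp [hsum0 j]
    · simp
  rw [e1, e2, e3] at hbound
  have hW_fin : volume W ≠ ⊤ := by
    refine ne_top_of_le_ne_top ?_ (measure_mono (fun ω hω => hω.1 : W ⊆ unitBox d))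
    simp [unitBox, volume_pi_pi]
  have h1 : 0 < volume.real W := ENNReal.toReal_pos hWpos hW_fin
  have h2 : 0 < ∑ k ∈ K, ‖c k‖ ^ 2 := by
    refine Finset.sum_pos' (fun _ _ => by positivity) ⟨k₀, hθK hk₀, ?_⟩
    have : c k₀ ≠ 0 := by simpa [hc, hk₀] using hgk₀
    positivity
  exact absurd hbound (not_le.2 (by positivity))

end Frame

/-- For a bounded measurable `Ω ⊆ ℝ^d` of positive measure and `a₁, …, a_m ∈ ℝ^d`, the
exponentials `e^{2πi⟨a_j + λ, ·⟩}`, `1 ≤ j ≤ m`, `λ ∈ ℤ^d`, form a frame of `L²(Ω)` if and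
only if for a.e. `ω ∈ [0,1)^d` the vectors `(e^{2πi⟨a_1,k⟩}, …, e^{2πi⟨a_m,k⟩}) ∈ ℂ^m`,
for `k ∈ ℤ^d` with `ω + k ∈ Ω`, are linearly independent. -/
theorem frame_iff_ae_linearIndependent
    (d m : ℕ) (Ω : Set (Fin d → ℝ)) (hΩmeas : MeasurableSet Ω)
    (hΩbdd : Bornology.IsBounded Ω) (hΩpos : 0 < volume Ω)
    (a : Fin m → (Fin d → ℝ)) :
    IsFrame (volume.restrict Ω)
        (fun p : Fin m × (Fin d → ℤ) => expChar (a p.1 + fun i => (p.2 i : ℝ)))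
      ↔ ∀ᵐ ω ∂(volume.restrict (unitBox d)),
          LinearIndependent ℂ
            (fun k : {k : Fin d → ℤ // (fun i => ω i + (k i : ℝ)) ∈ Ω} =>
              (fun j : Fin m =>
                Complex.exp (2 * Real.pi * Complex.I * ∑ i, a j i * ((k : Fin d → ℤ) i : ℝ))
                : Fin m → ℂ)) := by
  obtain ⟨K, hK⟩ := exists_finset_floorVec_mem hΩbdd
  change _ ↔ ∀ᵐ ω ∂(volume.restrict (unitBox d)),
    LinearIndepOn ℂ (fun k j => expChar (a j) (intVec k)) {k | ω + intVec k ∈ Ω}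
  refine ⟨fun h => ?_, isFrame_of_ae_linearIndepOn hΩmeas hΩbdd hK⟩
  classical
  have hθ : ∀ θ ∈ K.powerset, ∀ᵐ ω ∂(volume.restrict (unitBox d)),
      {k | ω + intVec k ∈ Ω} = (θ : Set (Fin d → ℤ)) →
      LinearIndepOn ℂ (fun k j => expChar (a j) (intVec k)) (θ : Set (Fin d → ℤ)) := by
    intro θ _
    by_cases hli : LinearIndepOn ℂ (fun k j => expChar (a j) (intVec k)) (θ : Set (Fin d → ℤ))
    · exact Filter.Eventually.of_forall fun _ _ => hli
    · rw [ae_restrict_iff' (measurableSet_unitBox d)]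
      have h0 := h.volume_eq_zero hΩmeas hΩbdd hK hli
      rw [measure_eq_zero_iff_ae_notMem] at h0
      filter_upwards [h0] with ω hω hωQ heq
      exact absurd ⟨hωQ, heq⟩ hω
  filter_upwards [(Finset.eventually_all _).2 hθ, ae_restrict_mem (measurableSet_unitBox d)]
    with ω hω hωQ
  have heq : {k | ω + intVec k ∈ Ω} =
      ((K.filter fun k => ω + intVec k ∈ Ω : Finset _) : Set _) := by
    ext k
    simp only [Set.mem_ofPred_eq, Finset.coe_filter, iff_and_self]
    intro hk
    simpa [floorVec_add_intVec hωQ] using hK _ hk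
  rw [heq]
  exact hω _ (by simp) heq
end

section
/- Let Ω = ⋃_{n=0}^∞ ( n + (2^{-(n+1)}, 2^{-n}] ) ⊆ ℝ. Then: (a) Ω is not a bounded set; (b) ∑_{k∈ℤ} 1_Ω(x+k) = 1 for every x ∈ ℝ \ ℤ, so (Ω, ℤ) is a tiling pair of ℝ; and (c) the family of exponentials {x ↦ e^{2πikx} restricted to Ω : k ∈ ℤ} is an orthonormal basis of L²(Ω). -/
open MeasureTheory ENNReal

/-- The unbounded set `Ω = ⋃_{n ≥ 0} (n + (2^{-(n+1)}, 2^{-n}]) ⊆ ℝ`. -/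
def omegaSet : Set ℝ :=
  ⋃ n : ℕ, Set.Ioc ((n : ℝ) + 1 / 2 ^ (n + 1)) ((n : ℝ) + 1 / 2 ^ n)

/-- The index `n` of the dyadic interval `(2^{-(n+1)}, 2^{-n}]` containing `y ∈ (0, 1]`. -/
noncomputable def dyadicIndex (y : ℝ) : ℕ := Nat.log 2 ⌊y⁻¹⌋₊

/-- The representative of `x` modulo `ℤ` lying in `omegaSet`. -/
noncomputable def omegaRep (x : ℝ) : ℝ := (x - ⌈x⌉ + 1) + dyadicIndex (x - ⌈x⌉ + 1)

lemma dyadicIndex_eq_iff {y : ℝ} (h₀ : 0 < y) (h₁ : y ≤ 1) (n : ℕ) :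
    dyadicIndex y = n ↔ y ∈ Set.Ioc (1 / 2 ^ (n + 1) : ℝ) (1 / 2 ^ n) := by
  have hy : 1 ≤ y⁻¹ := (one_le_inv₀ h₀).2 h₁
  have hf : ⌊y⁻¹⌋₊ ≠ 0 := (Nat.floor_pos.2 hy).ne'
  rw [dyadicIndex, Nat.log_eq_iff (Or.inr ⟨one_lt_two, hf⟩), Nat.le_floor_iff (by positivity),
    Nat.floor_lt (by positivity), Set.mem_Ioc, one_div, one_div, inv_lt_comm₀ (by positivity) h₀,
    le_inv_comm₀ h₀ (by positivity), and_comm]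
  push_cast
  rfl

lemma measurable_omegaRep : Measurable omegaRep := by
  have h : Measurable fun x : ℝ => x - ⌈x⌉ + 1 := by fun_prop
  have hd : Measurable dyadicIndex :=
    (measurable_from_top (f := Nat.log 2)).comp (Nat.measurable_floor.comp measurable_inv)
  exact h.add ((measurable_from_top (f := fun n : ℕ => (n : ℝ))).comp (hd.comp h))

lemma omegaRep_mem (x : ℝ) : omegaRep x ∈ omegaSet := by
  have h₀ : 0 < x - ⌈x⌉ + 1 := by linarith [Int.ceil_lt_add_one x]
  have h₁ : x - ⌈x⌉ + 1 ≤ 1 := by linarith [Int.le_ceil x]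
  have h := (dyadicIndex_eq_iff h₀ h₁ _).1 rfl
  refine Set.mem_iUnion.2 ⟨dyadicIndex (x - ⌈x⌉ + 1), ?_, ?_⟩
  · rw [omegaRep]; linarith [h.1]
  · rw [omegaRep]; linarith [h.2]

lemma omegaRep_add_intCast (x : ℝ) (k : ℤ) : omegaRep (x + k) = omegaRep x := by
  have h : x + k - ⌈x + k⌉ + 1 = x - ⌈x⌉ + 1 := by
    rw [Int.ceil_add_intCast]; push_cast; ring
  rw [omegaRep, h, omegaRep]

lemma exists_omegaRep_eq_add (x : ℝ) : ∃ k : ℤ, omegaRep x = x + k :=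
  ⟨1 - ⌈x⌉ + dyadicIndex (x - ⌈x⌉ + 1), by rw [omegaRep]; push_cast; ring⟩

lemma omegaRep_eq_self {x : ℝ} (hx : x ∈ omegaSet) : omegaRep x = x := by
  obtain ⟨n, hn₁, hn₂⟩ := Set.mem_iUnion.1 hx
  have hp : (0 : ℝ) < 1 / 2 ^ (n + 1) := by positivity
  have hq : (1 : ℝ) / 2 ^ n ≤ 1 := by
    rw [div_le_one (by positivity)]; exact one_le_pow₀ one_le_two
  have hc : ⌈x⌉ = (n : ℤ) + 1 := by
    rw [Int.ceil_eq_iff]; push_cast; constructor <;> linarith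
  have hy : x - ⌈x⌉ + 1 = x - n := by rw [hc]; push_cast; ring
  have hd : dyadicIndex (x - n) = n :=
    (dyadicIndex_eq_iff (by linarith) (by linarith) n).2 ⟨by linarith, by linarith⟩
  rw [omegaRep, hy, hd, sub_add_cancel]

lemma existsUnique_add_intCast_mem_omegaSet (x : ℝ) : ∃! k : ℤ, x + k ∈ omegaSet := by
  obtain ⟨k, hk⟩ := exists_omegaRep_eq_add x
  refine ⟨k, by simpa only [hk] using omegaRep_mem x, fun l hl => ?_⟩
  have h := omegaRep_eq_self hl
  rw [omegaRep_add_intCast, hk] at h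
  exact_mod_cast (add_left_cancel h).symm

lemma measurableSet_omegaSet : MeasurableSet omegaSet :=
  MeasurableSet.iUnion fun _ => measurableSet_Ioc

lemma isAddFundamentalDomain_omegaSet :
    IsAddFundamentalDomain (AddSubgroup.zmultiples (1 : ℝ)) omegaSet volume := by
  refine IsAddFundamentalDomain.mk' measurableSet_omegaSet.nullMeasurableSet fun x => ?_
  have : Function.Bijective
      (Set.codRestrict (fun n : ℤ => n • (1 : ℝ)) (AddSubgroup.zmultiples (1 : ℝ))
        fun n => ⟨n, rfl⟩) :=
    (Equiv.ofInjective (fun n : ℤ => n • (1 : ℝ))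
      (zsmul_left_strictMono one_pos).injective).bijective
  refine this.existsUnique_iff.2 ?_
  simpa [AddSubgroup.vadd_def, add_comm] using existsUnique_add_intCast_mem_omegaSet x

lemma vadd_eq_of_add_intCast {E : Type*} {f : ℝ → E} (hf : ∀ (x : ℝ) (k : ℤ), f (x + k) = f x)
    (g : AddSubgroup.zmultiples (1 : ℝ)) (x : ℝ) : f (g +ᵥ x) = f x := by
  obtain ⟨_, k, rfl⟩ := g
  simpa [AddSubgroup.vadd_def, add_comm] using hf x k

lemma isAddFundamentalDomain_Ioc_zero_one :
    IsAddFundamentalDomain (AddSubgroup.zmultiples (1 : ℝ)) (Set.Ioc (0 : ℝ) 1) volume := by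
  simpa using isAddFundamentalDomain_Ioc (one_pos : (0 : ℝ) < 1) 0

lemma setIntegral_omegaSet_eq_intervalIntegral {E : Type*} [NormedAddCommGroup E] [NormedSpace ℝ E]
    {f : ℝ → E} (hf : ∀ (x : ℝ) (k : ℤ), f (x + k) = f x) :
    ∫ x in omegaSet, f x = ∫ x in (0 : ℝ)..1, f x := by
  rw [intervalIntegral.integral_of_le zero_le_one]
  exact isAddFundamentalDomain_omegaSet.setIntegral_eq isAddFundamentalDomain_Ioc_zero_one
    (vadd_eq_of_add_intCast hf)

lemma exp_two_pi_I_mul_add_intCast (n : ℤ) (x : ℝ) (k : ℤ) :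
    Complex.exp (2 * Real.pi * Complex.I * n * ((x + k : ℝ) : ℂ)) =
      Complex.exp (2 * Real.pi * Complex.I * n * x) := by
  rw [Complex.exp_eq_exp_iff_exists_int]
  exact ⟨n * k, by push_cast; ring⟩

lemma conj_exp_two_pi_I_mul (n : ℤ) (x : ℝ) :
    (starRingEnd ℂ) (Complex.exp (2 * Real.pi * Complex.I * n * x)) =
      Complex.exp (2 * Real.pi * Complex.I * (-n : ℤ) * x) := by
  rw [← Complex.exp_conj]
  simp [Complex.conj_ofNat]

lemma intervalIntegral_exp_two_pi_I_mul (n : ℤ) :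
    ∫ x in (0 : ℝ)..1, Complex.exp (2 * Real.pi * Complex.I * n * x) = if n = 0 then 1 else 0 := by
  split_ifs with hn
  · simp [hn]
  · have hc : 2 * Real.pi * Complex.I * n ≠ 0 :=
      mul_ne_zero Complex.two_pi_I_ne_zero (Int.cast_ne_zero.2 hn)
    have h : Complex.exp (2 * Real.pi * Complex.I * n) = 1 :=
      Complex.exp_eq_one_iff.2 ⟨n, by ring⟩
    rw [integral_exp_mul_complex hc]
    simp [h]

lemma not_isBounded_omegaSet : ¬ Bornology.IsBounded omegaSet := by
  intro h
  obtain ⟨C, hC⟩ := h.exists_norm_le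
  obtain ⟨n, hn⟩ := exists_nat_gt C
  have hp : (0 : ℝ) < 1 / 2 ^ n := by positivity
  have hm : (n : ℝ) + 1 / 2 ^ n ∈ omegaSet := by
    refine Set.mem_iUnion.2 ⟨n, ?_, le_rfl⟩
    gcongr
    · norm_num
    · exact n.lt_succ_self
  linarith [hC _ hm, Real.le_norm_self ((n : ℝ) + 1 / 2 ^ n)]

lemma tsum_indicator_omegaSet (x : ℝ) :
    ∑' k : ℤ, omegaSet.indicator (fun _ => (1 : ℝ≥0∞)) (x + (k : ℝ)) = 1 := by
  obtain ⟨k, hk, hu⟩ := existsUnique_add_intCast_mem_omegaSet x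
  rw [tsum_eq_single k fun l hl => Set.indicator_of_notMem (fun h => hl (hu l h)) _]
  exact Set.indicator_of_mem hk _

lemma setIntegral_omegaSet_exp_mul_conj_exp (k l : ℤ) :
    ∫ x in omegaSet, Complex.exp (2 * Real.pi * Complex.I * k * x) *
        (starRingEnd ℂ) (Complex.exp (2 * Real.pi * Complex.I * l * x)) =
      if k = l then 1 else 0 := by
  have h (x : ℝ) : Complex.exp (2 * Real.pi * Complex.I * k * x) *
      (starRingEnd ℂ) (Complex.exp (2 * Real.pi * Complex.I * l * x)) =
        Complex.exp (2 * Real.pi * Complex.I * (k - l : ℤ) * x) := by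
    rw [conj_exp_two_pi_I_mul, ← Complex.exp_add]
    congr 1
    push_cast
    ring
  simp_rw [h]
  rw [setIntegral_omegaSet_eq_intervalIntegral (exp_two_pi_I_mul_add_intCast _),
    intervalIntegral_exp_two_pi_I_mul]
  simp only [sub_eq_zero]

lemma L2_norm_sq_eq_integral {α : Type*} {m : MeasurableSpace α} {μ : Measure α}
    (f : Lp ℂ 2 μ) : ‖f‖ ^ 2 = ∫ x, ‖f x‖ ^ 2 ∂μ := by
  have h := congr_arg RCLike.re (L2.inner_def (𝕜 := ℂ) f f)
  rw [← integral_re (L2.integrable_inner f f)] at h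
  simpa only [← norm_sq_eq_re_inner] using h

lemma tsum_sq_norm_setIntegral_omegaSet (f : Lp ℂ 2 (volume.restrict omegaSet)) :
    ∑' k : ℤ, ‖∫ x in omegaSet,
        f x * (starRingEnd ℂ) (Complex.exp (2 * Real.pi * Complex.I * k * x))‖ ^ 2 = ‖f‖ ^ 2 := by
  set G : ℝ → ℂ := fun x => f (omegaRep x) with hG
  have hGper (x : ℝ) (k : ℤ) : G (x + k) = G x := by simp only [hG, omegaRep_add_intCast]
  have hGeq (x : ℝ) (hx : x ∈ omegaSet) : f x = G x := by simp only [hG, omegaRep_eq_self hx]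
  have hGmeas : StronglyMeasurable G := (Lp.stronglyMeasurable f).comp_measurable measurable_omegaRep
  have hsq : IntegrableOn (fun x => ‖G x‖ ^ 2) omegaSet :=
    IntegrableOn.congr_fun ((memLp_two_iff_integrable_sq_norm (Lp.aestronglyMeasurable f)).1
      (Lp.memLp f)) (fun x hx => by simp only [hGeq x hx]) measurableSet_omegaSet
  have hL2 : MemLp G 2 (volume.restrict (Set.Ioc (0 : ℝ) 1)) :=
    (memLp_two_iff_integrable_sq_norm hGmeas.aestronglyMeasurable).2
      ((isAddFundamentalDomain_omegaSet.integrableOn_iff isAddFundamentalDomain_Ioc_zero_one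
        (vadd_eq_of_add_intCast fun x k => by simp only [hGper])).1 hsq)
  have hnorm : ‖f‖ ^ 2 = ∫ x in (0 : ℝ)..1, ‖G x‖ ^ 2 := by
    rw [L2_norm_sq_eq_integral, ← setIntegral_omegaSet_eq_intervalIntegral
      fun x k => by simp only [hGper]]
    exact setIntegral_congr_fun measurableSet_omegaSet fun x hx => by simp only [hGeq x hx]
  have hcoeff (k : ℤ) : ∫ x in omegaSet,
      f x * (starRingEnd ℂ) (Complex.exp (2 * Real.pi * Complex.I * k * x)) =
        fourierCoeffOn (zero_lt_one' ℝ) G k := by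
    simp_rw [conj_exp_two_pi_I_mul]
    rw [fourierCoeffOn_eq_integral, setIntegral_congr_fun measurableSet_omegaSet
        (g := fun x : ℝ => G x * Complex.exp (2 * Real.pi * Complex.I * (-k : ℤ) * x))
        fun x hx => by simp only [hGeq x hx],
      setIntegral_omegaSet_eq_intervalIntegral
        fun x l => by rw [hGper, exp_two_pi_I_mul_add_intCast]]
    simp only [fourier_coe_apply, smul_eq_mul, mul_comm (G _)]
    simp
  simp_rw [hcoeff]
  rw [tsum_sq_fourierCoeffOn _ hL2, hnorm]
  simp

/-- The set `Ω = ⋃_{n ≥ 0} (n + (2^{-(n+1)}, 2^{-n}])` is unbounded, tiles `ℝ` by `ℤ`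
at every non-integer point, and the integer exponentials `{e^{2πikx} : k ∈ ℤ}` restricted
to `Ω` form an orthonormal basis of `L²(Ω)` (orthonormality together with the Parseval
identity). -/
theorem unbounded_tile_with_exponential_onb :
    (¬ Bornology.IsBounded omegaSet) ∧
    (∀ x : ℝ, (∀ n : ℤ, x ≠ (n : ℝ)) →
      (∑' k : ℤ, omegaSet.indicator (fun _ => (1 : ℝ≥0∞)) (x + (k : ℝ))) = 1) ∧
    (∀ k l : ℤ,
      (∫ x in omegaSet, Complex.exp (2 * Real.pi * Complex.I * k * x) *
          (starRingEnd ℂ) (Complex.exp (2 * Real.pi * Complex.I * l * x)))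
        = if k = l then 1 else 0) ∧
    (∀ f : Lp ℂ 2 (volume.restrict omegaSet),
      (∑' k : ℤ, ‖∫ x in omegaSet,
          f x * (starRingEnd ℂ) (Complex.exp (2 * Real.pi * Complex.I * k * x))‖ ^ 2)
        = ‖f‖ ^ 2) := by
  exact ⟨not_isBounded_omegaSet, fun x _ => tsum_indicator_omegaSet x,
    setIntegral_omegaSet_exp_mul_conj_exp, tsum_sq_norm_setIntegral_omegaSet⟩
end

section
/- Let H be an abelian group, Γ ⊆ H a subgroup, and Q ⊆ H a set such that the translates {Q + γ : γ ∈ Γ} are pairwise disjoint and cover H. Let Ω ⊆ H be a subset such that for every ω ∈ Q the set θ_ω := {γ ∈ Γ : ω + γ ∈ Ω} is finite. For an integer k ≥ 1 let Q_k = {ω ∈ Q : #θ_ω = k}, and for a finite subset B ⊆ Γ with #B = k let Q_k(B) = {ω ∈ Q_k : ω + γ ∈ Ω for all γ ∈ B}. Then: (i) if B and B' are two distinct subsets of Γ with #B = #B' = k, then Q_k(B) ∩ Q_k(B') = ∅; and (ii) Ω = ⋃_{k≥1} ⋃_{B⊆Γ, #B=k} ⋃_{γ∈B} (Q_k(B)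 + γ), and the sets Q_k(B) + γ appearing in this union (over distinct triples (k, B, γ) with γ ∈ B) are pairwise disjoint. -/
/-- The set `Q_k(B) = {ω ∈ Q_k : ω + γ ∈ Ω for all γ ∈ B}`, where
`Q_k = {ω ∈ Q : #{γ ∈ Γ : ω + γ ∈ Ω} = k}`. -/
def QkB {H : Type*} [AddCommGroup H] (Γ : AddSubgroup H) (Ω Q : Set H)
    (k : ℕ) (B : Finset Γ) : Set H :=
  {ω ∈ Q | {γ : Γ | ω + (γ : H) ∈ Ω}.ncard = k ∧ ∀ γ ∈ B, ω + (γ : H) ∈ Ω}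

/-- A point of `Q_k(B)` with `#B = k ≥ 1` determines `B` as its fiber. -/
theorem coe_eq_fiber_of_mem_QkB {H : Type*} [AddCommGroup H] {Γ : AddSubgroup H} {Ω Q : Set H}
    {k : ℕ} {B : Finset Γ} {ω : H} (hk : 1 ≤ k) (hB : B.card = k) (hω : ω ∈ QkB Γ Ω Q k B) :
    (B : Set Γ) = {γ : Γ | ω + (γ : H) ∈ Ω} := by
  obtain ⟨-, hcard, hsub⟩ := hω
  refine Set.eq_of_subset_of_ncard_le hsub ?_ (Set.finite_of_ncard_pos (by omega))
  rw [Set.ncard_coe_finset, hcard, hB]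

/-- Structural decomposition of a set `Ω` with finite fibers over a fundamental domain `Q`
of a subgroup `Γ`: the sets `Q_k(B)` for distinct `B` of the same cardinality are disjoint,
and `Ω` is the disjoint union of the translates `Q_k(B) + γ` over `k ≥ 1`, `B ⊆ Γ` with
`#B = k`, and `γ ∈ B`. -/
theorem omega_decomposition
    {H : Type*} [AddCommGroup H] (Γ : AddSubgroup H) (Ω Q : Set H)
    (hdisj : ∀ γ₁ γ₂ : Γ, γ₁ ≠ γ₂ →
      Disjoint ((· + (γ₁ : H)) '' Q) ((· + (γ₂ : H)) '' Q))
    (hcover : (⋃ γ : Γ, (· + (γ : H)) '' Q) = Set.univ)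
    (hfin : ∀ ω ∈ Q, {γ : Γ | ω + (γ : H) ∈ Ω}.Finite) :
    (∀ k : ℕ, 1 ≤ k → ∀ B B' : Finset Γ, B.card = k → B'.card = k → B ≠ B' →
      QkB Γ Ω Q k B ∩ QkB Γ Ω Q k B' = ∅) ∧
    (Ω = ⋃ (k : ℕ) (_ : 1 ≤ k) (B : Finset Γ) (_ : B.card = k) (γ : Γ) (_ : γ ∈ B),
      (· + (γ : H)) '' QkB Γ Ω Q k B) ∧
    (∀ k k' : ℕ, ∀ B B' : Finset Γ, ∀ γ γ' : Γ,
      1 ≤ k → B.card = k → γ ∈ B → 1 ≤ k' → B'.card = k' → γ' ∈ B' →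
      (k, B, γ) ≠ (k', B', γ') →
      Disjoint ((· + (γ : H)) '' QkB Γ Ω Q k B) ((· + (γ' : H)) '' QkB Γ Ω Q k' B')) := by
  refine ⟨fun k hk B B' hB hB' hne => ?_, ?_, ?_⟩
  · refine Set.eq_empty_of_forall_notMem fun ω ⟨h, h'⟩ => hne (Finset.coe_injective ?_)
    rw [coe_eq_fiber_of_mem_QkB hk hB h, coe_eq_fiber_of_mem_QkB hk hB' h']
  · ext x
    simp only [Set.mem_iUnion, exists_prop]
    constructor
    · intro hx
      obtain ⟨γ, ω, hω, rfl⟩ := Set.mem_iUnion.1 (hcover.symm ▸ Set.mem_univ x)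
      have hγ : γ ∈ (hfin ω hω).toFinset := (hfin ω hω).mem_toFinset.2 hx
      exact ⟨_, Finset.card_pos.2 ⟨γ, hγ⟩, _, rfl, γ, hγ, ω,
        ⟨hω, Set.ncard_eq_toFinset_card _ (hfin ω hω), fun δ hδ =>
          (hfin ω hω).mem_toFinset.1 hδ⟩, rfl⟩
    · rintro ⟨k, -, B, -, γ, hγ, ω, hω, rfl⟩
      exact hω.2.2 γ hγ
  · intro k k' B B' γ γ' hk hB _ hk' hB' _ hne
    rw [Set.disjoint_left]
    rintro _ ⟨ω, hω, rfl⟩ ⟨ω', hω', heq⟩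
    obtain rfl : γ = γ' := by
      by_contra hγ
      exact Set.disjoint_left.1 (hdisj γ γ' hγ) ⟨ω, hω.1, rfl⟩ ⟨ω', hω'.1, heq⟩
    obtain rfl : ω' = ω := add_right_cancel heq
    obtain rfl : B = B' := Finset.coe_injective <| by
      rw [coe_eq_fiber_of_mem_QkB hk hB hω, coe_eq_fiber_of_mem_QkB hk' hB' hω']
    exact hne (by rw [← hB, ← hB'])
end
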